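/- arXiv:2011.12842 — 2 statements merged into one kernel-verified Lean document; each statement's English description precedes it below -/
import Mathlib

section
/- For every 0 < ε < 1/2 and n ≥ 1 there exists a C^∞ map R : I^n → J^{n-1}, where J^{n-1} = ∂I^{n-1} × I ∪ I^{n-1} × {1} ⊆ I^n = I^{n-1} × I, such that R restricts to the identity on the ε-chamber J^{n-1}(ε). -/
def cube (n : ℕ) : Set (Fin n → ℝ) := {t | ∀ j, t j ∈ Set.Icc (0 : ℝ) 1}

/-- `Jⁿ = ∂Iⁿ × I ∪ Iⁿ × {1} ⊆ Iⁿ⁺¹` (coordinates `0,…,n-1` are the `Iⁿ` factor,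
coordinate `n` is the last interval factor). -/
def Jset (n : ℕ) : Set (Fin (n + 1) → ℝ) :=
  {t | (∀ j, t j ∈ Set.Icc (0 : ℝ) 1) ∧
    ((∃ j : Fin n, t j.castSucc = 0 ∨ t j.castSucc = 1) ∨ t (Fin.last n) = 1)}

/-- The `ε`-chamber of `Jⁿ`: the union of the `ε`-chambers of its maximal faces, namely
the faces `F × I` for `F` an `(n-1)`-face of `∂Iⁿ`, and the top face `Iⁿ × {1}`. -/
def JChamber (n : ℕ) (ε : ℝ) : Set (Fin (n + 1) → ℝ) :=
  {t | ∃ (j : Fin n), (t j.castSucc = 0 ∨ t j.castSucc = 1) ∧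
      (∀ k : Fin (n + 1), k ≠ j.castSucc → t k ∈ Set.Icc ε (1 - ε))} ∪
  {t | t (Fin.last n) = 1 ∧ ∀ j : Fin n, t j.castSucc ∈ Set.Icc ε (1 - ε)}

/-- Taming function: `0` for `x ≤ ε/2`, `1` for `x ≥ 1 - ε/2`, identity on `[ε, 1-ε]`. -/
noncomputable def tame (ε x : ℝ) : ℝ :=
  Real.smoothTransition (2 / ε * x - 1) *
    (1 - Real.smoothTransition (2 / ε * (1 - x) - 1) * (1 - x))

/-- Cutoff: `0` at `x = 0, 1`, and `1` on `[ε/2, 1-ε/2]`. -/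
noncomputable def cutoff (ε x : ℝ) : ℝ :=
  Real.smoothTransition (2 / ε * x) * Real.smoothTransition (2 / ε * (1 - x))

theorem tame_contDiff (ε : ℝ) : ContDiff ℝ (⊤ : ℕ∞) (tame ε) := by
  unfold tame
  exact (Real.smoothTransition.contDiff.comp (by fun_prop)).mul
    (contDiff_const.sub ((Real.smoothTransition.contDiff.comp (by fun_prop)).mul (by fun_prop)))

theorem cutoff_contDiff (ε : ℝ) : ContDiff ℝ (⊤ : ℕ∞) (cutoff ε) := by
  unfold cutoff
  exact (Real.smoothTransition.contDiff.comp (by fun_prop)).mul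
    (Real.smoothTransition.contDiff.comp (by fun_prop))

theorem scale_ge {ε x c : ℝ} (hε : 0 < ε) (h : c * ε ≤ 2 * x) : c ≤ 2 / ε * x := by
  rw [div_mul_eq_mul_div, le_div_iff₀ hε]; exact h

theorem scale_le {ε x c : ℝ} (hε : 0 < ε) (h : 2 * x ≤ c * ε) : 2 / ε * x ≤ c := by
  rw [div_mul_eq_mul_div, div_le_iff₀ hε]; exact h

theorem tame_low {ε x : ℝ} (hε : 0 < ε) (h : x ≤ ε / 2) : tame ε x = 0 := by
  have := scale_le (c := 1) hε (x := x) (by linarith)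
  unfold tame
  rw [Real.smoothTransition.zero_of_nonpos (by linarith), zero_mul]

theorem tame_high {ε x : ℝ} (hε : 0 < ε) (hε' : ε < 1 / 2) (h : 1 - ε / 2 ≤ x) :
    tame ε x = 1 := by
  have h1 := scale_le (c := 1) hε (x := 1 - x) (by linarith)
  have h2 := scale_ge (c := 2) hε (x := x) (by linarith)
  unfold tame
  rw [Real.smoothTransition.zero_of_nonpos (x := 2 / ε * (1 - x) - 1) (by linarith),
    Real.smoothTransition.one_of_one_le (by linarith)]
  ring

theorem tame_mid {ε x : ℝ} (hε : 0 < ε) (h : x ∈ Set.Icc ε (1 - ε)) : tame ε x = x := by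
  have h1 := scale_ge (c := 2) hε (x := 1 - x) (by linarith [h.2])
  have h2 := scale_ge (c := 2) hε (x := x) (by linarith [h.1])
  unfold tame
  rw [Real.smoothTransition.one_of_one_le (x := 2 / ε * (1 - x) - 1) (by linarith),
    Real.smoothTransition.one_of_one_le (by linarith)]
  ring

theorem tame_mem {ε x : ℝ} (h : x ∈ Set.Icc (0 : ℝ) 1) : tame ε x ∈ Set.Icc (0 : ℝ) 1 := by
  have hx : 1 - x ∈ Set.Icc (0 : ℝ) 1 := ⟨by linarith [h.2], by linarith [h.1]⟩
  have key : ∀ y, Real.smoothTransition y ∈ unitInterval := fun y =>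
    ⟨Real.smoothTransition.nonneg y, Real.smoothTransition.le_one y⟩
  have h1 := unitInterval.mul_mem (key (2 / ε * (1 - x) - 1)) hx
  exact unitInterval.mul_mem (key _) ⟨by linarith [h1.2], by linarith [h1.1]⟩

theorem cutoff_mem (ε x : ℝ) : cutoff ε x ∈ Set.Icc (0 : ℝ) 1 :=
  unitInterval.mul_mem ⟨Real.smoothTransition.nonneg _, Real.smoothTransition.le_one _⟩
    ⟨Real.smoothTransition.nonneg _, Real.smoothTransition.le_one _⟩

theorem cutoff_mid {ε x : ℝ} (hε : 0 < ε) (h1 : ε / 2 ≤ x) (h2 : x ≤ 1 - ε / 2) :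
    cutoff ε x = 1 := by
  unfold cutoff
  rw [Real.smoothTransition.one_of_one_le (scale_ge hε (by linarith)),
    Real.smoothTransition.one_of_one_le (scale_ge hε (by linarith)), one_mul]

theorem cutoff_end {ε x : ℝ} (h : x = 0 ∨ x = 1) : cutoff ε x = 0 := by
  rcases h with rfl | rfl <;> simp [cutoff]

/-- Existence of a smooth `ε`-approximate retraction `R : Iⁿ⁺¹ → Jⁿ` which restricts to
the identity on the `ε`-chamber `Jⁿ(ε)`. -/
theorem stmt_8 (n : ℕ) (ε : ℝ) (hε : 0 < ε) (hε' : ε < 1 / 2) :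
    ∃ R : (Fin (n + 1) → ℝ) → (Fin (n + 1) → ℝ),
      ContDiff ℝ (⊤ : ℕ∞) R ∧
      Set.MapsTo R (cube (n + 1)) (Jset n) ∧
      Set.EqOn R id (JChamber n ε) := by
  refine ⟨fun t => Fin.snoc (α := fun _ => ℝ) (fun j : Fin n => tame ε (t j.castSucc))
    (t (Fin.last n) + (1 - t (Fin.last n)) * ∏ j : Fin n, cutoff ε (t j.castSucc)),
    ?_, ?_, ?_⟩
  · rw [contDiff_pi]
    intro i
    refine Fin.lastCases ?_ (fun j => ?_) i
    · simp only [Fin.snoc_last]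
      refine ContDiff.add (by fun_prop) (ContDiff.mul (by fun_prop) ?_)
      exact contDiff_prod fun j _ => (cutoff_contDiff ε).comp (by fun_prop)
    · simp only [Fin.snoc_castSucc]
      exact (tame_contDiff ε).comp (by fun_prop)
  · intro t ht
    refine ⟨fun i => ?_, ?_⟩
    · refine Fin.lastCases ?_ (fun j => ?_) i
      · simp only [Fin.snoc_last]
        have hu := ht (Fin.last n)
        have hc0 : 0 ≤ ∏ j : Fin n, cutoff ε (t j.castSucc) :=
          Finset.prod_nonneg fun j _ => (cutoff_mem _ _).1
        have hc1 : ∏ j : Fin n, cutoff ε (t j.castSucc) ≤ 1 :=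
          Finset.prod_le_one (fun j _ => (cutoff_mem _ _).1) fun j _ => (cutoff_mem _ _).2
        constructor
        · nlinarith [hu.1, hu.2]
        · nlinarith [hu.1, hu.2]
      · simp only [Fin.snoc_castSucc]
        exact tame_mem (ht _)
    · simp only [Fin.snoc_last, Fin.snoc_castSucc]
      by_cases h : ∃ j : Fin n, t j.castSucc ≤ ε / 2 ∨ 1 - ε / 2 ≤ t j.castSucc
      · obtain ⟨j, hj⟩ := h
        exact Or.inl ⟨j, hj.imp (tame_low hε) (tame_high hε hε')⟩
      · push Not at h
        right
        rw [Finset.prod_eq_one fun j _ => cutoff_mid hε (h j).1.le (h j).2.le]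
        ring
  · rintro t (⟨j, hj, hk⟩ | ⟨h1, h⟩)
    · funext i
      refine Fin.lastCases ?_ (fun k => ?_) i
      · simp only [Fin.snoc_last, id]
        rw [Finset.prod_eq_zero (Finset.mem_univ j) (cutoff_end hj)]
        ring
      · simp only [Fin.snoc_castSucc, id]
        by_cases hkj : k = j
        · subst hkj
          rcases hj with hj | hj
          · rw [hj]; exact tame_low hε (by linarith)
          · rw [hj]; exact tame_high hε hε' (by linarith)
        · exact tame_mid hε (hk _ fun h => hkj (Fin.castSucc_injective n h))
    · funext i
      refine Fin.lastCases ?_ (fun k => ?_) i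
      · simp [h1]
      · simp only [Fin.snoc_castSucc, id]
        exact tame_mid hε (h k)
end

section
/- J^n = ∂I^n × I ∪ I^n × {1} ⊆ I^{n+1} is smoothly contractible: there is a smooth (tame) homotopy r : J^n × I → J^n with r(·,0) = id, r(·,1) constant at e = (1,…,1), and r(e,t) = e for all t. -/
/-- `Jⁿ` is smoothly contractible to `e = (1,…,1)`: there is a smooth homotopy
`r : Jⁿ × I → Jⁿ` (the restriction of a `C^∞` map) with `r(·,0) = id`, `r(·,1) = e`,
and `r(e,s) = e` for all `s`. -/
theorem stmt_14 (n : ℕ) :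
    ∃ r : (Fin (n + 1) → ℝ) × ℝ → (Fin (n + 1) → ℝ),
      ContDiff ℝ (⊤ : ℕ∞) r ∧
      (∀ t ∈ Jset n, ∀ s ∈ Set.Icc (0 : ℝ) 1, r (t, s) ∈ Jset n) ∧
      (∀ t ∈ Jset n, r (t, 0) = t) ∧
      (∀ t ∈ Jset n, r (t, 1) = fun _ => (1 : ℝ)) ∧
      (∀ s ∈ Set.Icc (0 : ℝ) 1, r ((fun _ => (1 : ℝ)), s) = fun _ => (1 : ℝ)) := by
  have hT0 : ∀ x : ℝ, x ≤ 0 → Real.smoothTransition x = 0 :=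
    fun x hx => Real.smoothTransition.zero_of_nonpos hx
  have hT1 : ∀ x : ℝ, 1 ≤ x → Real.smoothTransition x = 1 :=
    fun x hx => Real.smoothTransition.one_of_one_le hx
  refine ⟨fun p j => 1 - (1 - p.1 j) *
    (1 - Real.smoothTransition (2 * p.2 - (if j = Fin.last n then 0 else 1))), ?_, ?_, ?_, ?_, ?_⟩
  · rw [contDiff_pi]
    intro j
    have h1 : ContDiff ℝ (⊤ : ℕ∞) (fun p : (Fin (n + 1) → ℝ) × ℝ => p.1 j) :=
      (contDiff_apply ℝ ℝ j).comp contDiff_fst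
    have h2 : ContDiff ℝ (⊤ : ℕ∞) (fun p : (Fin (n + 1) → ℝ) × ℝ =>
        Real.smoothTransition (2 * p.2 - (if j = Fin.last n then 0 else 1))) :=
      Real.smoothTransition.contDiff.comp
        ((contDiff_const.mul contDiff_snd).sub contDiff_const)
    exact contDiff_const.sub ((contDiff_const.sub h1).mul (contDiff_const.sub h2))
  · rintro t ⟨ht, hJ⟩ s hs
    refine ⟨fun j => ?_, ?_⟩
    · obtain ⟨h0, h1⟩ := ht j
      have a0 := Real.smoothTransition.nonneg (2 * s - (if j = Fin.last n then 0 else 1))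
      have a1 := Real.smoothTransition.le_one (2 * s - (if j = Fin.last n then 0 else 1))
      constructor <;> dsimp only <;> nlinarith
    · rcases le_total s (1 / 2) with h | h
      · rcases hJ with ⟨j, hj⟩ | hl
        · left
          refine ⟨j, ?_⟩
          have : j.castSucc ≠ Fin.last n := (Fin.castSucc_lt_last j).ne
          simpa [this, hT0 (2 * s - 1) (by linarith)] using hj
        · right
          simp [hl]
      · right
        simp [hT1 (2 * s) (by linarith)]
  · intro t _
    funext j
    dsimp only
    rw [hT0 _ (by split_ifs <;> norm_num)]
    ring
  · intro t _
    funext j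
    dsimp only
    rw [hT1 _ (by split_ifs <;> norm_num)]
    ring
  · intro s _
    funext j
    simp
end
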